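/- arXiv:2401.01015 — 3 statements merged into one kernel-verified Lean document; each statement's English description precedes it below -/
import Mathlib

section
/- Let M be a sober MT-algebra. The map α sending a compact saturated element s of M to α(s) = {a ∈ M | s ≤ □a} is an order-isomorphism from the poset of compact saturated elements of M ordered by the reverse order ≥ onto the poset of Scott-open filters of M ordered by inclusion; in particular α(s) is a Scott-open filter for each compact saturated s, and every Scott-open filter F satisfies F = α(⋀F) with ⋀F compact saturated. -/
/-- An MT-algebra: a complete Boolean algebra with an interior operator. -/
structure MTAlg (M : Type*) [CompleteBooleanAlgebra M] where
  box : M → M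
  box_top : box ⊤ = ⊤
  box_inf : ∀ a b : M, box (a ⊓ b) = box a ⊓ box b
  box_le : ∀ a : M, box a ≤ a
  box_idem : ∀ a : M, box a ≤ box (box a)

namespace MTAlg

variable {M : Type*} [CompleteBooleanAlgebra M] (T : MTAlg M)

/-- The closure (dual) operator. -/
def dia (a : M) : M := (T.box aᶜ)ᶜ

/-- Open elements. -/
def IsOpenElem (a : M) : Prop := T.box a = a

/-- Closed elements. -/
def IsClosedElem (a : M) : Prop := T.dia a = a

/-- Saturated elements: meets of open elements. -/
def IsSaturatedElem (a : M) : Prop :=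
  ∃ S : Set M, (∀ s ∈ S, T.IsOpenElem s) ∧ a = sInf S

/-- Weakly locally closed elements: meets of a saturated and a closed element. -/
def IsWLC (a : M) : Prop :=
  ∃ s c : M, T.IsSaturatedElem s ∧ T.IsClosedElem c ∧ a = s ⊓ c

/-- T0-algebras: every element is a join of weakly locally closed elements. -/
def IsT0 : Prop :=
  ∀ a : M, ∃ S : Set M, (∀ b ∈ S, T.IsWLC b) ∧ a = sSup S

/-- T1-algebras: every element is a join of closed elements. -/
def IsT1 : Prop :=
  ∀ a : M, ∃ S : Set M, (∀ b ∈ S, T.IsClosedElem b) ∧ a = sSup S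

/-- Join-irreducible elements of the lattice of closed elements. -/
def JoinIrredClosed (p : M) : Prop :=
  T.IsClosedElem p ∧ p ≠ ⊥ ∧
    ∀ a b : M, T.IsClosedElem a → T.IsClosedElem b → p = a ⊔ b → p = a ∨ p = b

/-- Sober MT-algebras. -/
def Sober : Prop :=
  T.IsT0 ∧ ∀ p : M, T.JoinIrredClosed p → ∃ x : M, IsAtom x ∧ p = T.dia x

/-- Filters of the underlying lattice. -/
def IsFilter (F : Set M) : Prop :=
  ⊤ ∈ F ∧ (∀ a b : M, a ∈ F → a ≤ b → b ∈ F) ∧ (∀ a b : M, a ∈ F → b ∈ F → a ⊓ b ∈ F)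

/-- Open filters. -/
def IsOpenFilter (F : Set M) : Prop :=
  IsFilter F ∧ ∀ a ∈ F, T.box a ∈ F

/-- Scott-open filters. -/
def IsScottOpenFilter (F : Set M) : Prop :=
  T.IsOpenFilter F ∧
    ∀ S : Set M, (∀ s ∈ S, T.IsOpenElem s) → S.Nonempty → DirectedOn (· ≤ ·) S →
      sSup S ∈ F → ∃ s ∈ S, s ∈ F

/-- Compact elements. -/
def IsCompactElem (a : M) : Prop :=
  ∀ S : Set M, (∀ s ∈ S, T.IsOpenElem s) → a ≤ sSup S →
    ∃ t ⊆ S, t.Finite ∧ a ≤ sSup t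

/-- The relation `a ◁ b`: there is a compact element between `a` and `b`. -/
def Triangle (a b : M) : Prop := ∃ k : M, T.IsCompactElem k ∧ a ≤ k ∧ k ≤ b

/-- Locally compact MT-algebras. -/
def LocallyCompact : Prop :=
  ∀ u : M, T.IsOpenElem u → u = sSup {v : M | T.IsOpenElem v ∧ T.Triangle v u}

/-- The way-below relation in the frame of open elements. -/
def WayBelowOpen (a b : M) : Prop :=
  ∀ S : Set M, (∀ s ∈ S, T.IsOpenElem s) → b ≤ sSup S →
    ∃ t ⊆ S, t.Finite ∧ a ≤ sSup t

/-- Elements approximated from above by regular closed elements. -/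
def GC (a : M) : Prop :=
  a = sInf {b : M | ∃ c : M, a ≤ T.box c ∧ b = T.dia (T.box c)}

/-- Hausdorff MT-algebras. -/
def IsHausdorff : Prop :=
  ∀ a : M, ∃ S : Set M, (∀ b ∈ S, T.GC b) ∧ a = sSup S

/-- Regular MT-algebras. -/
def IsRegular : Prop :=
  T.IsT1 ∧ ∀ a : M, T.IsOpenElem a →
    a = sSup {b : M | T.IsOpenElem b ∧ T.dia b ≤ a}

end MTAlg

/-- The atom space of a complete Boolean algebra. -/
abbrev AtomSpace (M : Type*) [CompleteBooleanAlgebra M] : Type _ := {x : M // IsAtom x}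

/-- The set of atoms below an element. -/
def eta {M : Type*} [CompleteBooleanAlgebra M] (a : M) : Set (AtomSpace M) :=
  {x : AtomSpace M | x.1 ≤ a}

namespace MTAlg

variable {M : Type*} [CompleteBooleanAlgebra M] (T : MTAlg M)

/-- The topology on the atom space, generated by the images of open elements. -/
def atTop : TopologicalSpace (AtomSpace M) :=
  TopologicalSpace.generateFrom {U : Set (AtomSpace M) | ∃ u : M, T.IsOpenElem u ∧ U = eta u}

end MTAlg

namespace MTAlg

variable {M : Type*} [CompleteBooleanAlgebra M] (T : MTAlg M)

theorem box_mono {a b : M} (h : a ≤ b) : T.box a ≤ T.box b := by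
  have hab := T.box_inf a b
  rw [inf_eq_left.2 h] at hab
  exact inf_eq_left.1 hab.symm

theorem isOpenElem_box (a : M) : T.IsOpenElem (T.box a) :=
  le_antisymm (T.box_le _) (T.box_idem _)

theorem isOpenElem_sSup {S : Set M} (hS : ∀ s ∈ S, T.IsOpenElem s) : T.IsOpenElem (sSup S) := by
  refine le_antisymm (T.box_le _) (sSup_le fun s hs => ?_)
  exact (hS s hs).ge.trans (T.box_mono (le_sSup hs))

theorem isClosedElem_compl {a : M} : T.IsClosedElem aᶜ ↔ T.IsOpenElem a := by
  simp [IsClosedElem, IsOpenElem, dia]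

theorem isOpenElem_compl {a : M} : T.IsOpenElem aᶜ ↔ T.IsClosedElem a := by
  rw [← isClosedElem_compl, compl_compl]

theorem le_dia (a : M) : a ≤ T.dia a :=
  le_compl_comm.1 (T.box_le aᶜ)

theorem dia_le_iff {a c : M} (hc : T.IsClosedElem c) : T.dia a ≤ c ↔ a ≤ c := by
  refine ⟨(T.le_dia a).trans, fun h => ?_⟩
  rw [← hc]
  exact compl_le_compl (T.box_mono (compl_le_compl h))

/-- The complement of a meet-irreducible open element different from `⊤` is join-irreducible among the
closed elements. -/
theorem joinIrredClosed_compl {v : M} (hv : T.IsOpenElem v) (hne : v ≠ ⊤)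
    (hirr : ∀ a b : M, T.IsOpenElem a → T.IsOpenElem b → v = a ⊓ b → v = a ∨ v = b) :
    T.JoinIrredClosed vᶜ := by
  refine ⟨T.isClosedElem_compl.2 hv, by simpa using hne, fun a b ha hb hab => ?_⟩
  have hv' : v = aᶜ ⊓ bᶜ := by rw [← compl_sup, ← hab, compl_compl]
  refine (hirr aᶜ bᶜ (T.isOpenElem_compl.2 ha) (T.isOpenElem_compl.2 hb) hv').imp ?_ ?_ <;>
  · intro h
    rw [h, compl_compl]

variable {T}

theorem IsCompactElem.isScottOpenFilter {s : M} (hs : T.IsCompactElem s) :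
    T.IsScottOpenFilter {a : M | s ≤ T.box a} := by
  refine ⟨⟨⟨?_, fun a b ha hab => le_trans ha (T.box_mono hab), fun a b ha hb => ?_⟩,
    fun a ha => le_trans ha (T.box_idem a)⟩, fun S hS hne hdir hsup => ?_⟩
  · simp [T.box_top]
  · simpa [T.box_inf] using And.intro ha hb
  · obtain ⟨t, htS, htfin, hst⟩ := hs S hS (le_trans hsup (T.box_le _))
    have := hne.to_subtype
    obtain ⟨⟨m, hm⟩, hmt⟩ :=
      hdir.directed_val.finite_set_le (htfin.preimage Subtype.val_injective.injOn)
    exact ⟨m, hm, (hst.trans (sSup_le fun x hx => hmt ⟨x, htS hx⟩ hx)).trans (hS m hm).ge⟩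

/-- A Scott-open filter omitting an open element `u` omits a maximal open element above `u`. -/
theorem IsScottOpenFilter.exists_maximal {F : Set M} (hF : T.IsScottOpenFilter F) {u : M}
    (hu : T.IsOpenElem u) (huF : u ∉ F) :
    ∃ v, u ≤ v ∧ Maximal (fun w => T.IsOpenElem w ∧ w ∉ F) v := by
  refine zorn_le_nonempty₀ {w | T.IsOpenElem w ∧ w ∉ F} (fun c hc hchain y hy => ?_) u ⟨hu, huF⟩
  refine ⟨sSup c, ⟨T.isOpenElem_sSup fun s hs => (hc hs).1, fun hmem => ?_⟩, fun z => le_sSup⟩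
  obtain ⟨s, hs, hsF⟩ := hF.2 c (fun s hs => (hc hs).1) ⟨y, hy⟩ hchain.directedOn hmem
  exact (hc hs).2 hsF

theorem IsScottOpenFilter.mem_of_sInf_le (hsob : T.Sober) {F : Set M}
    (hF : T.IsScottOpenFilter F) {u : M} (hu : T.IsOpenElem u) (h : sInf F ≤ u) : u ∈ F := by
  by_contra huF
  obtain ⟨v, huv, ⟨hv, hvF⟩, hmax⟩ := hF.exists_maximal hu huF
  obtain ⟨⟨⟨htop, hup, hinf⟩, hbox⟩, -⟩ := hF
  have hlarge : ∀ a, T.IsOpenElem a → v ≤ a → v ≠ a → a ∈ F := fun a ha hva hne => by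
    by_contra haF
    exact hne (hva.antisymm (hmax ⟨ha, haF⟩ hva))
  have hirr : T.JoinIrredClosed vᶜ := by
    refine T.joinIrredClosed_compl hv (fun hv' => hvF (hv' ▸ htop)) fun a b ha hb hab => ?_
    by_contra! hne
    refine hvF (hab ▸ hinf a b ?_ ?_)
    · exact hlarge a ha (hab.le.trans inf_le_left) hne.1
    · exact hlarge b hb (hab.le.trans inf_le_right) hne.2
  obtain ⟨x, hx, hvx⟩ := hsob.2 _ hirr
  have hxF : x ≤ sInf F := le_sInf fun w hw => by
    refine le_trans ?_ (T.box_le w)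
    by_contra hxw
    have hle : T.dia x ≤ (T.box w)ᶜ :=
      (T.dia_le_iff (T.isClosedElem_compl.2 (T.isOpenElem_box w))).2
        (hx.not_le_iff_disjoint.1 hxw).le_compl_right
    rw [← hvx, compl_le_compl_iff_le] at hle
    exact hvF (hup _ _ (hbox w hw) hle)
  have hxv : x ≤ v := hxF.trans (h.trans huv)
  have hxv' : x ≤ vᶜ := hvx ▸ T.le_dia x
  exact hx.1 (le_bot_iff.1 ((le_inf hxv hxv').trans inf_compl_eq_bot.le))

theorem IsOpenFilter.isSaturatedElem_sInf {F : Set M} (hF : T.IsOpenFilter F) :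
    T.IsSaturatedElem (sInf F) := by
  refine ⟨{a ∈ F | T.IsOpenElem a}, fun s hs => hs.2,
    le_antisymm (sInf_le_sInf fun a ha => ha.1) (le_sInf fun a ha => ?_)⟩
  have hmem : T.box a ∈ {a ∈ F | T.IsOpenElem a} := ⟨hF.2 a ha, T.isOpenElem_box a⟩
  exact (sInf_le hmem).trans (T.box_le a)

theorem IsScottOpenFilter.isCompactElem_sInf (hsob : T.Sober) {F : Set M}
    (hF : T.IsScottOpenFilter F) : T.IsCompactElem (sInf F) := by
  intro S hS hle
  have hmem : sSup S ∈ F := hF.mem_of_sInf_le hsob (T.isOpenElem_sSup hS) hle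
  have hsup : sSup S ≤ sSup (sSup '' {t | t ⊆ S ∧ t.Finite}) := sSup_le fun s hs =>
    le_sSup ⟨{s}, ⟨Set.singleton_subset_iff.2 hs, Set.finite_singleton s⟩, sSup_singleton⟩
  obtain ⟨-, ⟨t, ⟨htS, htfin⟩, rfl⟩, htF⟩ := hF.2 (sSup '' {t | t ⊆ S ∧ t.Finite})
    (by
      rintro - ⟨t, ⟨htS, -⟩, rfl⟩
      exact T.isOpenElem_sSup fun s hs => hS s (htS hs))
    ⟨_, ∅, ⟨Set.empty_subset S, Set.finite_empty⟩, rfl⟩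
    (by
      rintro - ⟨t, ht, rfl⟩ - ⟨t', ht', rfl⟩
      exact ⟨_, ⟨t ∪ t', ⟨Set.union_subset ht.1 ht'.1, ht.2.union ht'.2⟩, rfl⟩,
        sSup_le_sSup Set.subset_union_left, sSup_le_sSup Set.subset_union_right⟩)
    (hF.1.1.2.1 _ _ hmem hsup)
  exact ⟨t, htS, htfin, sInf_le htF⟩

theorem IsScottOpenFilter.eq_setOf_sInf_le_box (hsob : T.Sober) {F : Set M}
    (hF : T.IsScottOpenFilter F) : F = {a : M | sInf F ≤ T.box a} := by
  ext a
  refine ⟨fun ha => sInf_le (hF.1.2 a ha), fun ha => ?_⟩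
  exact hF.1.1.2.1 _ _ (hF.mem_of_sInf_le hsob (T.isOpenElem_box a) ha) (T.box_le a)

theorem IsSaturatedElem.setOf_le_box_subset_iff {s t : M} (hs : T.IsSaturatedElem s) :
    {a : M | s ≤ T.box a} ⊆ {a : M | t ≤ T.box a} ↔ t ≤ s := by
  refine ⟨fun h => ?_, fun h a ha => h.trans ha⟩
  obtain ⟨S, hS, rfl⟩ := hs
  refine le_sInf fun u hu => ?_
  have hmem : sInf S ≤ T.box u := (sInf_le hu).trans (hS u hu).ge
  exact (h hmem : t ≤ T.box u).trans (T.box_le u)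

end MTAlg


/-- Hofmann–Mislove theorem for sober MT-algebras: `α s = {a | s ≤ □a}` is an
order-isomorphism from compact saturated elements (ordered by `≥`) onto
Scott-open filters (ordered by `⊆`). -/
theorem hofmann_mislove_MT {M : Type*} [CompleteBooleanAlgebra M] (T : MTAlg M)
    (hsob : T.Sober) :
    (∀ s : M, T.IsCompactElem s → T.IsSaturatedElem s →
        T.IsScottOpenFilter {a : M | s ≤ T.box a}) ∧
    (∃ e : ({s : M // T.IsCompactElem s ∧ T.IsSaturatedElem s})ᵒᵈ ≃o
        {F : Set M // T.IsScottOpenFilter F},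
      ∀ s : {s : M // T.IsCompactElem s ∧ T.IsSaturatedElem s},
        (e (OrderDual.toDual s)).1 = {a : M | s.1 ≤ T.box a}) ∧
    (∀ F : Set M, T.IsScottOpenFilter F →
        T.IsCompactElem (sInf F) ∧ T.IsSaturatedElem (sInf F) ∧
          F = {a : M | sInf F ≤ T.box a}) := by
  refine ⟨fun s hs _ => hs.isScottOpenFilter, ?_, fun F hF =>
    ⟨hF.isCompactElem_sInf hsob, hF.1.isSaturatedElem_sInf, hF.eq_setOf_sInf_le_box hsob⟩⟩
  let f : ({s : M // T.IsCompactElem s ∧ T.IsSaturatedElem s})ᵒᵈ ↪o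
      {F : Set M // T.IsScottOpenFilter F} :=
    OrderEmbedding.ofMapLEIff
      (fun s => ⟨{a : M | (OrderDual.ofDual s).1 ≤ T.box a},
        (OrderDual.ofDual s).2.1.isScottOpenFilter⟩)
      fun s _ => (OrderDual.ofDual s).2.2.setOf_le_box_subset_iff
  have hf : Function.Surjective f := fun F =>
    ⟨OrderDual.toDual ⟨sInf F.1, F.2.isCompactElem_sInf hsob, F.2.1.isSaturatedElem_sInf⟩,
      Subtype.ext (F.2.eq_setOf_sInf_le_box hsob).symm⟩
  exact ⟨RelIso.ofSurjective f hf, fun _ => rfl⟩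
end

section
/- (Hofmann–Mislove for frames) For every frame L, the poset of Scott-open filters of L ordered by inclusion is isomorphic to the poset of compact saturated subsets of the space pt(L) ordered by reverse inclusion ⊇. -/
/-- A filter of a frame. -/
def FrameFilter {L : Type*} [Order.Frame L] (F : Set L) : Prop :=
  ⊤ ∈ F ∧ (∀ a b : L, a ∈ F → a ≤ b → b ∈ F) ∧ (∀ a b : L, a ∈ F → b ∈ F → a ⊓ b ∈ F)

/-- A Scott-open filter of a frame. -/
def ScottOpenFrameFilter {L : Type*} [Order.Frame L] (F : Set L) : Prop :=
  FrameFilter F ∧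
    ∀ S : Set L, S.Nonempty → DirectedOn (· ≤ ·) S → sSup S ∈ F → ∃ s ∈ S, s ∈ F

/-- A completely prime filter of a frame. -/
def CPFilter {L : Type*} [Order.Frame L] (p : Set L) : Prop :=
  FrameFilter p ∧ ∀ S : Set L, sSup S ∈ p → ∃ s ∈ S, s ∈ p

/-- The space of points (completely prime filters) of a frame. -/
abbrev PtSpace (L : Type*) [Order.Frame L] : Type _ := {p : Set L // CPFilter p}

instance ptTopology (L : Type*) [Order.Frame L] : TopologicalSpace (PtSpace L) :=
  TopologicalSpace.generateFrom {U : Set (PtSpace L) | ∃ a : L, U = {p : PtSpace L | a ∈ p.1}}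

/-- The basic open set of the point space associated with a frame element. -/
def zeta {L : Type*} [Order.Frame L] (a : L) : TopologicalSpace.Opens (PtSpace L) :=
  ⟨{p : PtSpace L | a ∈ p.1}, TopologicalSpace.isOpen_generateFrom_of_mem ⟨a, rfl⟩⟩

/-- Saturated subsets of a topological space: intersections of open sets. -/
def IsSaturatedSet {X : Type*} [TopologicalSpace X] (K : Set X) : Prop :=
  ∃ U : Set (Set X), (∀ u ∈ U, IsOpen u) ∧ K = ⋂₀ U

theorem CPFilter.sSup_mem_iff {L : Type*} [Order.Frame L] {p : Set L} (hp : CPFilter p)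
    (S : Set L) : sSup S ∈ p ↔ ∃ s ∈ S, s ∈ p :=
  ⟨hp.2 S, fun ⟨s, hs, hsp⟩ => hp.1.2.1 s _ hsp (le_sSup hs)⟩

theorem mem_zeta {L : Type*} [Order.Frame L] {a : L} {p : PtSpace L} :
    p ∈ (zeta a : Set (PtSpace L)) ↔ a ∈ p.1 :=
  Iff.rfl

/-- Every open subset of the point space comes from an element of the frame. -/
theorem PtSpace.exists_eq_zeta {L : Type*} [Order.Frame L] {U : Set (PtSpace L)}
    (hU : IsOpen U) : ∃ a : L, U = zeta a := by
  induction hU with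
  | basic s hs => exact hs
  | univ => exact ⟨⊤, (Set.eq_univ_of_forall fun p => p.2.1.1).symm⟩
  | inter s t _ _ hs ht =>
    obtain ⟨a, rfl⟩ := hs
    obtain ⟨b, rfl⟩ := ht
    refine ⟨a ⊓ b, Set.ext fun p => ⟨fun h => p.2.1.2.2 a b h.1 h.2, fun h => ⟨?_, ?_⟩⟩⟩
    · exact p.2.1.2.1 _ _ h inf_le_left
    · exact p.2.1.2.1 _ _ h inf_le_right
  | sUnion S _ ih =>
    refine ⟨sSup {a | (zeta a : Set (PtSpace L)) ∈ S}, Set.ext fun p => ?_⟩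
    rw [mem_zeta, p.2.sSup_mem_iff]
    constructor
    · rintro ⟨u, hu, hp⟩
      obtain ⟨a, rfl⟩ := ih u hu
      exact ⟨a, hu, hp⟩
    · rintro ⟨a, ha, hp⟩
      exact ⟨_, ha, hp⟩

/-- A Scott-open filter avoiding `a` extends to a completely prime filter avoiding `a`. -/
theorem ScottOpenFrameFilter.exists_cpFilter {L : Type*} [Order.Frame L] {F : Set L}
    (hF : ScottOpenFrameFilter F) {a : L} (ha : a ∉ F) :
    ∃ p : PtSpace L, F ⊆ p.1 ∧ a ∉ p.1 := by
  obtain ⟨m, ham, hm⟩ := zorn_le_nonempty₀ Fᶜ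
    (fun c hc hchain y hy => ⟨sSup c, fun h => by
      obtain ⟨s, hs, hsF⟩ := hF.2 c ⟨y, hy⟩ hchain.directedOn h
      exact hc hs hsF, fun z hz => le_sSup hz⟩) a ha
  have hsup : ∀ x, ¬ x ≤ m → m ⊔ x ∈ F := fun x hx => by
    by_contra h
    exact hx (le_sup_right.trans (hm.2 h le_sup_left))
  refine ⟨⟨{x | ¬ x ≤ m}, ⟨?_, ?_, ?_⟩, ?_⟩, fun x hx hxm => hm.1 (hF.1.2.1 x m hx hxm),
    fun h => h ham⟩
  · exact fun h => hm.1 (hF.1.2.1 ⊤ m hF.1.1 h)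
  · exact fun x y hx hxy hy => hx (hxy.trans hy)
  · intro x y hx hy h
    have hxy := hF.1.2.2 _ _ (hsup x hx) (hsup y hy)
    rw [← sup_inf_left, sup_eq_left.2 h] at hxy
    exact hm.1 hxy
  · intro S hS
    by_contra! h
    exact hS (sSup_le fun s hs => not_not.1 (h s hs))

/-- The set of points containing a given set of frame elements. -/
def pointsAbove {L : Type*} [Order.Frame L] (F : Set L) : Set (PtSpace L) :=
  {p | F ⊆ p.1}

/-- The set of frame elements belonging to every point of a given set. -/
def commonElements {L : Type*} [Order.Frame L] (K : Set (PtSpace L)) : Set L :=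
  {a | K ⊆ zeta a}

theorem ScottOpenFrameFilter.commonElements_pointsAbove {L : Type*} [Order.Frame L] {F : Set L}
    (hF : ScottOpenFrameFilter F) : commonElements (pointsAbove F) = F := by
  refine Set.Subset.antisymm (fun a ha => ?_) fun a ha p hp => hp ha
  by_contra h
  obtain ⟨p, hFp, hap⟩ := hF.exists_cpFilter h
  exact hap (ha hFp)

theorem isSaturatedSet_pointsAbove {L : Type*} [Order.Frame L] (F : Set L) :
    IsSaturatedSet (pointsAbove F) := by
  refine ⟨(fun a => (zeta a : Set (PtSpace L))) '' F, ?_, ?_⟩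
  · rintro _ ⟨a, _, rfl⟩
    exact (zeta a).isOpen
  · ext p
    simp [pointsAbove, Set.subset_def, zeta]

theorem ScottOpenFrameFilter.isCompact_pointsAbove {L : Type*} [Order.Frame L] {F : Set L}
    (hF : ScottOpenFrameFilter F) : IsCompact (pointsAbove F) := by
  classical
  refine isCompact_of_finite_subcover fun {ι} U hU hcover => ?_
  choose a ha using fun i => PtSpace.exists_eq_zeta (hU i)
  have hmem : sSup (Set.range fun t : Finset ι => t.sup a) ∈ F := by
    rw [← hF.commonElements_pointsAbove]
    intro p hp
    obtain ⟨i, hi⟩ := Set.mem_iUnion.1 (hcover hp)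
    rw [ha i] at hi
    exact (p.2.sSup_mem_iff _).2 ⟨_, ⟨{i}, rfl⟩, by simpa using! hi⟩
  have hdir : DirectedOn (· ≤ ·) (Set.range fun t : Finset ι => t.sup a) := by
    rintro _ ⟨s, rfl⟩ _ ⟨t, rfl⟩
    exact ⟨_, ⟨s ∪ t, rfl⟩, Finset.sup_mono Finset.subset_union_left,
      Finset.sup_mono Finset.subset_union_right⟩
  obtain ⟨_, ⟨t, rfl⟩, ht⟩ := hF.2 _ (Set.range_nonempty _) hdir hmem
  refine ⟨t, fun p hp => ?_⟩
  have hpt : t.sup a ∈ p.1 := hp ht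
  rw [Finset.sup_eq_sSup_image, p.2.sSup_mem_iff] at hpt
  obtain ⟨_, ⟨i, hi, rfl⟩, hip⟩ := hpt
  refine Set.mem_iUnion₂.2 ⟨i, hi, ?_⟩
  rw [ha i]
  exact hip

theorem scottOpenFrameFilter_commonElements {L : Type*} [Order.Frame L] {K : Set (PtSpace L)}
    (hK : IsCompact K) : ScottOpenFrameFilter (commonElements K) := by
  refine ⟨⟨fun p _ => p.2.1.1, fun a b ha hab p hp => p.2.1.2.1 a b (ha hp) hab,
    fun a b ha hb p hp => p.2.1.2.2 a b (ha hp) (hb hp)⟩, fun S hne hS hmem => ?_⟩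
  have : Nonempty S := hne.to_subtype
  obtain ⟨s, hs⟩ := hK.elim_directed_cover (fun s : S => (zeta s.1 : Set (PtSpace L)))
    (fun s => (zeta s.1).isOpen)
    (fun p hp => by
      obtain ⟨s, hs, hsp⟩ := p.2.2 S (hmem hp)
      exact Set.mem_iUnion.2 ⟨⟨s, hs⟩, hsp⟩)
    (fun s t => by
      obtain ⟨u, hu, hsu, htu⟩ := hS s.1 s.2 t.1 t.2
      exact ⟨⟨u, hu⟩, fun p hp => p.2.1.2.1 _ _ hp hsu, fun p hp => p.2.1.2.1 _ _ hp htu⟩)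
  exact ⟨s.1, s.2, hs⟩

theorem IsSaturatedSet.pointsAbove_commonElements {L : Type*} [Order.Frame L]
    {K : Set (PtSpace L)} (hK : IsSaturatedSet K) : pointsAbove (commonElements K) = K := by
  refine Set.Subset.antisymm (fun q hq => ?_) fun p hp a ha => ha hp
  obtain ⟨U, hU, rfl⟩ := hK
  intro u hu
  obtain ⟨a, rfl⟩ := PtSpace.exists_eq_zeta (hU u hu)
  exact hq (Set.sInter_subset_of_mem hu)

/-- Hofmann–Mislove for frames: the poset of Scott-open filters of `L` (ordered by `⊆`)
is isomorphic to the poset of compact saturated subsets of `pt L` ordered by `⊇`. -/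
theorem hofmann_mislove_frames (L : Type*) [Order.Frame L] :
    Nonempty ({F : Set L // ScottOpenFrameFilter F} ≃o
      ({K : Set (PtSpace L) // IsCompact K ∧ IsSaturatedSet K})ᵒᵈ) := by
  exact ⟨{
    toFun := fun F => OrderDual.toDual
      ⟨pointsAbove F.1, F.2.isCompact_pointsAbove, isSaturatedSet_pointsAbove F.1⟩
    invFun := fun K => ⟨commonElements (OrderDual.ofDual K).1,
      scottOpenFrameFilter_commonElements (OrderDual.ofDual K).2.1⟩
    left_inv := fun F => Subtype.ext F.2.commonElements_pointsAbove
    right_inv := fun K => Subtype.ext (OrderDual.ofDual K).2.2.pointsAbove_commonElements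
    map_rel_iff' := by
      intro F G
      refine ⟨fun h => ?_, fun h p hp => Set.Subset.trans h hp⟩
      have hGF : pointsAbove G.1 ⊆ pointsAbove F.1 := h
      change F.1 ⊆ G.1
      rw [← F.2.commonElements_pointsAbove, ← G.2.commonElements_pointsAbove]
      exact fun a ha => hGF.trans ha }⟩
end

section
/- If M is a locally compact MT-algebra, then O(M) is a continuous frame. -/
namespace MTAlg

theorem Triangle.wayBelowOpen {M : Type*} [CompleteBooleanAlgebra M] {T : MTAlg M} {a b : M}
    (h : T.Triangle a b) : T.WayBelowOpen a b := by
  intro S hS hb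
  obtain ⟨k, hk, hak, hkb⟩ := h
  obtain ⟨t, htS, ht, hkt⟩ := hk S hS (hkb.trans hb)
  exact ⟨t, htS, ht, hak.trans hkt⟩

theorem WayBelowOpen.le {M : Type*} [CompleteBooleanAlgebra M] {T : MTAlg M} {a b : M}
    (h : T.WayBelowOpen a b) (hb : T.IsOpenElem b) : a ≤ b := by
  obtain ⟨t, htb, -, hat⟩ := h {b} (by simpa using hb) (by simp)
  exact hat.trans ((sSup_le_sSup htb).trans_eq sSup_singleton)

end MTAlg

/-- If `M` is a locally compact MT-algebra, then the frame of open elements is continuous. -/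
theorem openFrame_continuous_of_locallyCompact {M : Type*} [CompleteBooleanAlgebra M]
    (T : MTAlg M) (hlc : T.LocallyCompact) :
    ∀ a : M, T.IsOpenElem a →
      a = sSup {v : M | T.IsOpenElem v ∧ T.WayBelowOpen v a} := by
  intro a ha
  refine le_antisymm ?_ (sSup_le ?_)
  · calc
      a = sSup {v : M | T.IsOpenElem v ∧ T.Triangle v a} := hlc a ha
      _ ≤ sSup {v : M | T.IsOpenElem v ∧ T.WayBelowOpen v a} :=
        sSup_le_sSup fun _ hv => ⟨hv.1, hv.2.wayBelowOpen⟩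
  · exact fun _ hv => hv.2.le ha
end
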